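/- arXiv:2111.05197 — 2 statements merged into one kernel-verified Lean document; each statement's English description precedes it below -/
import Mathlib

section
/- Let s > 0, x ∈ ℝ, and r ≥ 0. The Lebesgue measure of the set {a ∈ [0, s) : there exists k ∈ ℤ with |a + k·s − x| ≤ r} is at most min(2r, s); in particular, if a is chosen uniformly at random from [0, s), the probability that some point of the shifted grid {a + k·s : k ∈ ℤ} lies within distance r of x is at most 2r/s. -/
open MeasureTheory

/-- The portion of `[0, s)` congruent modulo `s` to a point of a measurable set `B` has volume at
most that of `B`. -/
theorem volume_Ico_inter_exists_add_zsmul_mem_le (s : ℝ) {B : Set ℝ} (hB : MeasurableSet B) :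
    volume {a : ℝ | a ∈ Set.Ico 0 s ∧ ∃ k : ℤ, a + k * s ∈ B} ≤ volume B := by
  let T : ℤ → Set ℝ := fun k => Set.Ico (k • s) ((k + 1) • s) ∩ B
  have hdisj : Pairwise (Function.onFun Disjoint T) := fun i j hij =>
    (Set.pairwise_disjoint_Ico_zsmul s hij).mono Set.inter_subset_left Set.inter_subset_left
  calc volume {a : ℝ | a ∈ Set.Ico 0 s ∧ ∃ k : ℤ, a + k * s ∈ B}
      ≤ volume (⋃ k : ℤ, (fun a : ℝ => a + k * s) ⁻¹' T k) := by
        refine measure_mono ?_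
        rintro a ⟨⟨h0, h1⟩, k, hk⟩
        refine Set.mem_iUnion.2 ⟨k, ⟨?_, ?_⟩, hk⟩ <;> simp only [zsmul_eq_mul] <;>
          push_cast <;> linarith
    _ ≤ ∑' k : ℤ, volume ((fun a : ℝ => a + k * s) ⁻¹' T k) := measure_iUnion_le _
    _ = ∑' k : ℤ, volume (T k) := by simp only [measure_preimage_add_right]
    _ = volume (⋃ k, T k) :=
        (measure_iUnion hdisj fun k => measurableSet_Ico.inter hB).symm
    _ ≤ volume B := measure_mono (Set.iUnion_subset fun _ => Set.inter_subset_right)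

/-- For a randomly shifted grid of spacing s, the set of offsets a ∈ [0, s) for which
some grid point a + k·s lies within distance r of a fixed point x has Lebesgue measure
at most min (2r) s; in particular the probability of this event for a uniform offset
is at most 2r / s. -/
theorem stmt7 (s x r : ℝ) (hs : 0 < s) (hr : 0 ≤ r) :
    volume {a : ℝ | a ∈ Set.Ico 0 s ∧ ∃ k : ℤ, |a + k * s - x| ≤ r}
      ≤ ENNReal.ofReal (min (2 * r) s) := by
  rw [ENNReal.ofReal_min]
  refine le_min ?_ ?_
  · have h := volume_Ico_inter_exists_add_zsmul_mem_le s
      (measurableSet_Icc (a := x - r) (b := x + r))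
    rw [Real.volume_Icc, show x + r - (x - r) = 2 * r by ring] at h
    refine (measure_mono ?_).trans h
    rintro a ⟨ha, k, hk⟩
    obtain ⟨h1, h2⟩ := abs_le.1 hk
    exact ⟨ha, k, by linarith, by linarith⟩
  · exact (measure_mono fun a ha => ha.1).trans_eq (by rw [Real.volume_Ico, sub_zero])
end

section
/- Let ε = 1/m for an integer m ≥ 2 and let J ∈ ℕ. For each j ∈ {0, 1, …, J} let L_j be a finite family of axis-parallel segments such that every horizontal segment in L_j has length at most ε^{j−1}, and suppose every vertical segment ℓ ∈ L_j is assigned an axis-aligned rectangle R_ℓ stabbed by ℓ whose width is at most ε^{j−1} if j ≥ 1 and at most 1 if j = 0. Choose the offset a uniformly at random from [0, ε^{−2}); call a segment ℓ ∈ L_j marked if either ℓ is horizontal and some vertical level-j grid line {a + k·ε^{j−2}} × ℝ (k ∈ ℤ) intersects ℓ, or ℓ is vertical and some vertical level-j grid line intersects R_ℓ. Then the expected total length of the marked segments is at most 3ε times the total length of all segments in L_0 ∪ … ∪ L_J. -/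
/-- An axis-parallel segment: `horiz = true` means a horizontal segment
`[lo, hi] × {pos}`, `horiz = false` means a vertical segment `{pos} × [lo, hi]`. -/
structure Seg where
  horiz : Bool
  lo : ℝ
  hi : ℝ
  pos : ℝ

/-- The length of a segment. -/
def Seg.length (s : Seg) : ℝ := s.hi - s.lo

/-- The segment `s` stabs the rectangle `[x1,x2] × [y1,y2]`. -/
def Seg.Stabs (s : Seg) (x1 x2 y1 y2 : ℝ) : Prop :=
  if s.horiz then s.lo ≤ x1 ∧ x2 ≤ s.hi ∧ y1 ≤ s.pos ∧ s.pos ≤ y2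
  else s.lo ≤ y1 ∧ y2 ≤ s.hi ∧ x1 ≤ s.pos ∧ s.pos ≤ x2

open MeasureTheory

/-- The set of offsets `a` for which the grid `a + ℤ p` meets the interval `[lo, hi]`. -/
def gridHits (lo hi p : ℝ) : Set ℝ :=
  {a | ∃ k : ℤ, lo ≤ a + k * p ∧ a + k * p ≤ hi}

theorem measurableSet_gridHits (lo hi p : ℝ) : MeasurableSet (gridHits lo hi p) := by
  have h : gridHits lo hi p = ⋃ k : ℤ, Set.Icc (lo - k * p) (hi - k * p) := by
    ext a
    simp only [gridHits, Set.mem_ofPred_eq, Set.mem_iUnion, Set.mem_Icc, sub_le_iff_le_add,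
      le_sub_iff_add_le]
  rw [h]
  exact MeasurableSet.iUnion fun _ => measurableSet_Icc

theorem periodic_indicator_gridHits (lo hi p c : ℝ) :
    Function.Periodic ((gridHits lo hi p).indicator fun _ => c) p := by
  intro a
  have h : a + p ∈ gridHits lo hi p ↔ a ∈ gridHits lo hi p := by
    constructor
    · rintro ⟨k, h₁, h₂⟩
      refine ⟨k + 1, ?_, ?_⟩ <;> push_cast <;> linarith
    · rintro ⟨k, h₁, h₂⟩
      refine ⟨k - 1, ?_, ?_⟩ <;> push_cast <;> linarith
  by_cases ha : a ∈ gridHits lo hi p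
  · simp [ha, h.2 ha]
  · simp [ha, mt h.1 ha]

theorem integral_indicator_gridHits_le {lo hi p c : ℝ} (hw : lo ≤ hi) (hp : 0 < p) (hc : 0 ≤ c)
    (n : ℕ) :
    ∫ a in Set.Ico (0 : ℝ) (n * p), (gridHits lo hi p).indicator (fun _ => c) a
      ≤ n * ((hi - lo) * c) := by
  set f : ℝ → ℝ := (gridHits lo hi p).indicator fun _ => c
  have hper : Function.Periodic f p := periodic_indicator_gridHits lo hi p c
  have hone : ∫ a in (hi - p)..(hi - p + p), f a ≤ (hi - lo) * c := by
    rw [intervalIntegral.integral_of_le (by linarith),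
      setIntegral_indicator (measurableSet_gridHits lo hi p), setIntegral_const, smul_eq_mul]
    refine mul_le_mul_of_nonneg_right ?_ hc
    calc volume.real (Set.Ioc (hi - p) (hi - p + p) ∩ gridHits lo hi p)
        ≤ volume.real (Set.Icc lo hi) := by
          refine measureReal_mono ?_ measure_Icc_lt_top.ne
          rintro a ⟨⟨h₁, h₂⟩, k, h₃, h₄⟩
          refine ⟨?_, by linarith⟩
          have hk : k ≤ 0 := by
            by_contra! hk
            have : (1 : ℝ) ≤ k := by exact_mod_cast hk
            nlinarith
          have : (k : ℝ) ≤ 0 := by exact_mod_cast hk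
          nlinarith
      _ = hi - lo := Real.volume_real_Icc_of_le hw
  have hall : ∫ a in (0 : ℝ)..(n * p), f a = n * ∫ a in (0 : ℝ)..p, f a := by
    have hint (t₁ t₂ : ℝ) : IntervalIntegrable f volume t₁ t₂ := by
      rw [intervalIntegrable_iff]
      exact (integrableOn_const measure_Ioc_lt_top.ne).indicator (measurableSet_gridHits lo hi p)
    simpa using hper.intervalIntegral_add_zsmul_eq n 0 hint
  rw [integral_Ico_eq_integral_Ioc, ← intervalIntegral.integral_of_le (by positivity), hall]
  refine mul_le_mul_of_nonneg_left ?_ n.cast_nonneg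
  rw [hper.intervalIntegral_add_eq (hi - p) 0] at hone
  simpa only [zero_add] using hone

/-- Expected cost of segments hit by random vertical grid lines. For each level
j ∈ {0, …, J}, let L j be a finite family of axis-parallel segments such that each
horizontal segment in L j has length at most ε^(j-1), and each vertical segment
s ∈ L j stabs an assigned rectangle [Rx1 j s, Rx2 j s] × [Ry1 j s, Ry2 j s] of width
at most ε^(j-1) for j ≥ 1 (at most 1 for j = 0).  A segment s ∈ L j is marked for
offset a if a vertical level-j grid line x = a + k·ε^(j-2) intersects s (horizontal
case) or intersects its assigned rectangle (vertical case).  Then the expected total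
length of marked segments, for a uniform offset a ∈ [0, ε⁻²) (expectation written as
an unnormalized integral, with the normalization ε⁻² multiplied on the right-hand
side), is at most 3ε times the total length of all segments. -/
theorem stmt9 (m : ℕ) (hm : 2 ≤ m) (ε : ℝ) (hε : ε = 1 / m) (J : ℕ)
    (L : ℕ → Finset Seg)
    (Rx1 Rx2 Ry1 Ry2 : ℕ → Seg → ℝ)
    (hseg : ∀ j ∈ Finset.range (J + 1), ∀ s ∈ L j, s.lo ≤ s.hi)
    (hhor : ∀ j ∈ Finset.range (J + 1), ∀ s ∈ L j, s.horiz = true →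
      s.length ≤ ε ^ ((j : ℤ) - 1))
    (hver : ∀ j ∈ Finset.range (J + 1), ∀ s ∈ L j, s.horiz = false →
      Rx1 j s < Rx2 j s ∧ Ry1 j s < Ry2 j s ∧
      s.Stabs (Rx1 j s) (Rx2 j s) (Ry1 j s) (Ry2 j s) ∧
      (j = 0 → Rx2 j s - Rx1 j s ≤ 1) ∧
      (1 ≤ j → Rx2 j s - Rx1 j s ≤ ε ^ ((j : ℤ) - 1))) :
    ∫ a in Set.Ico (0 : ℝ) (ε ^ (-2 : ℤ)),
        (∑ j ∈ Finset.range (J + 1), ∑ s ∈ L j,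
          Set.indicator {a' : ℝ |
              (s.horiz = true ∧
                ∃ k : ℤ, s.lo ≤ a' + k * ε ^ ((j : ℤ) - 2) ∧
                  a' + k * ε ^ ((j : ℤ) - 2) ≤ s.hi) ∨
              (s.horiz = false ∧
                ∃ k : ℤ, Rx1 j s ≤ a' + k * ε ^ ((j : ℤ) - 2) ∧
                  a' + k * ε ^ ((j : ℤ) - 2) ≤ Rx2 j s)}
            (fun _ => s.length) a)
      ≤ 3 * ε * ε ^ (-2 : ℤ) *
          ∑ j ∈ Finset.range (J + 1), ∑ s ∈ L j, s.length := by
  have hm' : (2 : ℝ) ≤ m := by exact_mod_cast hm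
  have hε0 : 0 < ε := by rw [hε]; positivity
  have hε1 : ε ≤ 1 := by
    rw [hε, div_le_one (by linarith)]
    linarith
  have hset (j : ℕ) (s : Seg) : ∃ lo hi : ℝ, {a' : ℝ |
              (s.horiz = true ∧
                ∃ k : ℤ, s.lo ≤ a' + k * ε ^ ((j : ℤ) - 2) ∧
                  a' + k * ε ^ ((j : ℤ) - 2) ≤ s.hi) ∨
              (s.horiz = false ∧
                ∃ k : ℤ, Rx1 j s ≤ a' + k * ε ^ ((j : ℤ) - 2) ∧
                  a' + k * ε ^ ((j : ℤ) - 2) ≤ Rx2 j s)} = gridHits lo hi (ε ^ ((j : ℤ) - 2)) ∧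
      (j ∈ Finset.range (J + 1) → s ∈ L j → lo ≤ hi ∧ hi - lo ≤ ε ^ ((j : ℤ) - 1)) := by
    cases hs : s.horiz with
    | true =>
      exact ⟨s.lo, s.hi, by simp [gridHits], fun hj h => ⟨hseg j hj s h, hhor j hj s h hs⟩⟩
    | false =>
      refine ⟨Rx1 j s, Rx2 j s, by simp [gridHits], fun hj h => ?_⟩
      obtain ⟨h₁, -, -, h₀, h₂⟩ := hver j hj s h hs
      refine ⟨h₁.le, ?_⟩
      rcases Nat.eq_zero_or_pos j with rfl | hj'
      · refine (h₀ rfl).trans ?_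
        simpa using (one_le_inv₀ hε0).2 hε1
      · exact h₂ hj'
  choose lo hi hset hlh using hset
  simp only [hset]
  have hint (j : ℕ) (s : Seg) : IntegrableOn
      ((gridHits (lo j s) (hi j s) (ε ^ ((j : ℤ) - 2))).indicator fun _ => s.length)
      (Set.Ico (0 : ℝ) (ε ^ (-2 : ℤ))) :=
    (integrableOn_const measure_Ico_lt_top.ne).indicator (measurableSet_gridHits _ _ _)
  rw [integral_finsetSum _ fun j _ => integrable_finsetSum _ fun s _ => hint j s, Finset.mul_sum]
  refine Finset.sum_le_sum fun j hj => ?_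
  rw [integral_finsetSum _ fun s _ => hint j s, Finset.mul_sum]
  refine Finset.sum_le_sum fun s hs => ?_
  obtain ⟨hle, hw⟩ := hlh j s hj hs
  have hlen : 0 ≤ s.length := sub_nonneg.2 (hseg j hj s hs)
  have hmj : ((m ^ j : ℕ) : ℝ) = ε ^ (-(j : ℤ)) := by
    rw [hε]
    simp
  have htop : ε ^ (-2 : ℤ) = ((m ^ j : ℕ) : ℝ) * ε ^ ((j : ℤ) - 2) := by
    rw [hmj, ← zpow_add₀ hε0.ne']
    congr 1
    ring
  have hscale : ((m ^ j : ℕ) : ℝ) * ε ^ ((j : ℤ) - 1) = ε * ε ^ (-2 : ℤ) := by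
    rw [hmj, ← zpow_add₀ hε0.ne', ← zpow_one_add₀ hε0.ne']
    congr 1
    ring
  calc ∫ a in Set.Ico (0 : ℝ) (ε ^ (-2 : ℤ)),
        (gridHits (lo j s) (hi j s) (ε ^ ((j : ℤ) - 2))).indicator (fun _ => s.length) a
      ≤ (m ^ j : ℕ) * ((hi j s - lo j s) * s.length) := by
        rw [htop]
        exact integral_indicator_gridHits_le hle (by positivity) hlen _
    _ ≤ (m ^ j : ℕ) * (ε ^ ((j : ℤ) - 1) * s.length) := by gcongr
    _ = ε * ε ^ (-2 : ℤ) * s.length := by rw [← mul_assoc, hscale]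
    _ ≤ 3 * ε * ε ^ (-2 : ℤ) * s.length := by
        gcongr
        linarith
end
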